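/- arXiv:1504.00127 — 2 statements merged into one kernel-verified Lean document; each statement's English description precedes it below -/
import Mathlib

section
/- Let Ω ⊆ ℝ^d be a domain with boundary Γ. Fix z ∈ Γ and r > 0, and assume there exist a > 0 and s ∈ [0, d−1] such that H^s_∞(Γ ∩ B(x; 2·d_Γ(x))) ≥ a·d_Γ(x)^s for all x ∈ Ω_{z,r} = Ω ∩ B(z;r). Then for each p ∈ (1,∞) and each real δ < p + s − d there exists b > 0 such that ∫_{Ω_{z,r}} d_Γ(x)^δ·|∇φ(x)|^p dx ≥ b·∫_{Ω_{z,r}} d_Γ(x)^{δ−p}·|φ(x)|^p dx for all φ ∈ C_c^∞(Ω_{z,r}). -/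
open MeasureTheory Metric Set
open scoped ENNReal NNReal

noncomputable section

/-- Euclidean space ℝ^d. -/
abbrev Euc (d : ℕ) : Type := EuclideanSpace ℝ (Fin d)


/-- The `s`-dimensional Hausdorff content `H^s_∞(E)`. -/
def hContent (d : ℕ) (s : ℝ) (E : Set (Euc d)) : ℝ≥0∞ :=
  ⨅ (U : ℕ → Set (Euc d)) (_ : E ⊆ ⋃ n, U n), ∑' n, EMetric.diam (U n) ^ s

/-- Fundamental theorem of calculus along a segment from a zero of `v`. -/
lemma ray_bound {d : ℕ} (v : Euc d → ℝ) (hv : ContDiff ℝ 1 v) (y u : Euc d) (hy : v y = 0) :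
    ‖v u‖ₑ ≤ ‖u - y‖ₑ * ∫⁻ t in Ioc (0 : ℝ) 1, ‖fderiv ℝ v (y + t • (u - y))‖ₑ := by
  have hder : ∀ t : ℝ, HasDerivAt (fun t : ℝ => v (y + t • (u - y)))
      (fderiv ℝ v (y + t • (u - y)) (u - y)) t := by
    intro t
    have h1 : HasDerivAt (fun t : ℝ => y + t • (u - y)) (u - y) t := by
      simpa using ((hasDerivAt_id t).smul_const (u - y)).const_add y
    have h2 := (hv.differentiable (by norm_num) (y + t • (u - y))).hasFDerivAt
    exact h2.comp_hasDerivAt t h1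
  have hcont : Continuous fun t : ℝ => fderiv ℝ v (y + t • (u - y)) := by
    have := hv.continuous_fderiv (by norm_num)
    fun_prop
  have hint := intervalIntegral.integral_eq_sub_of_hasDerivAt (a := 0) (b := 1)
    (fun t _ => hder t) ((hcont.clm_apply continuous_const).intervalIntegrable 0 1)
  have h3 : v u = ∫ t in Ioc (0 : ℝ) 1, fderiv ℝ v (y + t • (u - y)) (u - y) := by
    rw [← intervalIntegral.integral_of_le zero_le_one, hint]
    simp [hy]
  rw [h3]
  refine (enorm_integral_le_lintegral_enorm _).trans ?_
  rw [← lintegral_const_mul']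
  · refine lintegral_mono fun t => ?_
    rw [mul_comm]
    exact ContinuousLinearMap.le_opENorm _ _
  · simp

/-- Dilation of an integral over a ball. -/
lemma ball_dilate {d : ℕ} (h : Euc d → ℝ≥0∞) (y : Euc d) (ρ t : ℝ) (ht : 0 < t) :
    ∫⁻ u in ball y ρ, h (y + t • (u - y)) =
      ENNReal.ofReal ((t ^ d)⁻¹) * ∫⁻ ξ in ball y (t * ρ), h ξ := by
  rw [← lintegral_indicator measurableSet_ball, ← lintegral_indicator measurableSet_ball]
  have e1 : ∫⁻ u, (ball y ρ).indicator (fun u => h (y + t • (u - y))) u =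
      ∫⁻ u, (ball y (t * ρ)).indicator h (y + t • (u - y)) := by
    refine lintegral_congr fun u => ?_
    by_cases hu : u ∈ ball y ρ
    · rw [indicator_of_mem hu, indicator_of_mem]
      simp only [mem_ball, dist_eq_norm] at hu ⊢
      simp only [add_sub_cancel_left, norm_smul, Real.norm_eq_abs, abs_of_pos ht]
      gcongr
    · rw [indicator_of_notMem hu, indicator_of_notMem]
      simp only [mem_ball, dist_eq_norm] at hu ⊢
      simp only [add_sub_cancel_left, norm_smul, Real.norm_eq_abs, abs_of_pos ht]
      intro h
      exact hu (lt_of_mul_lt_mul_left h ht.le)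
  rw [e1]
  rw [lintegral_sub_right_eq_self (fun u => (ball y (t * ρ)).indicator h (y + t • u)) y]
  have e2 := lintegral_map_equiv (μ := (volume : Measure (Euc d)))
    (fun u => (ball y (t * ρ)).indicator h (y + u)) (MeasurableEquiv.smul₀ t ht.ne')
  have e3 : (⇑(MeasurableEquiv.smul₀ t ht.ne') : Euc d → Euc d) = fun x => t • x := rfl
  rw [e3, Measure.map_addHaar_smul _ ht.ne', lintegral_smul_measure] at e2
  rw [← e2, lintegral_add_left_eq_self (fun u => (ball y (t * ρ)).indicator h u) y,
    abs_of_pos (by positivity)]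
  simp

lemma ball_potential {d : ℕ} (v : Euc d → ℝ) (hv : ContDiff ℝ 1 v) (y : Euc d) (hy : v y = 0)
    (ρ : ℝ) :
    ∫⁻ u in ball y ρ, ‖v u‖ₑ ≤ ENNReal.ofReal ρ * ∫⁻ t in Ioc (0 : ℝ) 1,
      ENNReal.ofReal ((t ^ d)⁻¹) * ∫⁻ ξ in ball y (t * ρ), ‖fderiv ℝ v ξ‖ₑ := by
  have hc := hv.continuous_fderiv (by norm_num)
  calc ∫⁻ u in ball y ρ, ‖v u‖ₑ
      ≤ ∫⁻ u in ball y ρ, ENNReal.ofReal ρ *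
          ∫⁻ t in Ioc (0 : ℝ) 1, ‖fderiv ℝ v (y + t • (u - y))‖ₑ := by
        refine setLIntegral_mono' measurableSet_ball fun u hu => ?_
        refine (ray_bound v hv y u hy).trans ?_
        gcongr
        rw [← ofReal_norm]
        refine ENNReal.ofReal_le_ofReal ?_
        rw [mem_ball, dist_eq_norm] at hu
        exact hu.le
    _ = ENNReal.ofReal ρ * ∫⁻ u in ball y ρ, 
          ∫⁻ t in Ioc (0 : ℝ) 1, ‖fderiv ℝ v (y + t • (u - y))‖ₑ := by
        rw [lintegral_const_mul' _ _ ENNReal.ofReal_ne_top]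
    _ = ENNReal.ofReal ρ * ∫⁻ t in Ioc (0 : ℝ) 1, ∫⁻ u in ball y ρ, 
           ‖fderiv ℝ v (y + t • (u - y))‖ₑ := by
        rw [lintegral_lintegral_swap]
        refine Measurable.aemeasurable (Continuous.measurable ?_)
        simp only [Function.uncurry_def]
        fun_prop
    _ = _ := by
        congr 1
        refine setLIntegral_congr_fun measurableSet_Ioc fun t ht => ?_
        exact ball_dilate (fun ξ => ‖fderiv ℝ v ξ‖ₑ) y ρ t ht.1

/-- Selection of a good radius. -/
lemma good_radius {d : ℕ} (v : Euc d → ℝ) (hv : ContDiff ℝ 1 v) (y : Euc d) (hy : v y = 0)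
    (ρ : ℝ) (hρ : 0 < ρ) (ε : ℝ) (hε : 0 < ε) (M : ℝ) (hM0 : 0 < M)
    (hM : ENNReal.ofReal M ≤ ∫⁻ u in ball y ρ, ‖v u‖ₑ) :
    ∃ t : ℝ, 0 < t ∧ t ≤ 1 ∧ ENNReal.ofReal (M * ε / (2 * ρ) * t ^ ((d : ℝ) - 1 + ε)) ≤
      ∫⁻ ξ in ball y (t * ρ), ‖fderiv ℝ v ξ‖ₑ := by
  by_contra! hcon
  have h1 := hM.trans (ball_potential v hv y hy ρ)
  have h2 : ∫⁻ t in Ioc (0 : ℝ) 1,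
      ENNReal.ofReal ((t ^ d)⁻¹) * ∫⁻ ξ in ball y (t * ρ), ‖fderiv ℝ v ξ‖ₑ ≤
      ∫⁻ t in Ioc (0 : ℝ) 1, ENNReal.ofReal (M * ε / (2 * ρ) * t ^ (ε - 1)) := by
    refine setLIntegral_mono' measurableSet_Ioc fun t ht => ?_
    have h0 := ht.1
    calc _ ≤ ENNReal.ofReal ((t ^ d)⁻¹) * 
          ENNReal.ofReal (M * ε / (2 * ρ) * t ^ ((d : ℝ) - 1 + ε)) := by
            gcongr
            exact (hcon t ht.1 ht.2).le
      _ = _ := by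
        rw [← ENNReal.ofReal_mul (by positivity)]
        congr 1
        have : t ^ ((d : ℝ) - 1 + ε) = t ^ d * t ^ (ε - 1) := by
          rw [← Real.rpow_natCast, ← Real.rpow_add ht.1]; congr 1; ring
        rw [this]
        have : t ^ d ≠ 0 := by positivity
        field_simp
  have h3 : ∫⁻ t in Ioc (0 : ℝ) 1, ENNReal.ofReal (M * ε / (2 * ρ) * t ^ (ε - 1)) =
      ENNReal.ofReal (M / (2 * ρ)) := by
    rw [← ofReal_integral_eq_lintegral_ofReal]
    · congr 1
      rw [← intervalIntegral.integral_of_le zero_le_one, intervalIntegral.integral_const_mul,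
        integral_rpow (Or.inl (by linarith))]
      simp [Real.zero_rpow hε.ne']
      field_simp
    · have : IntervalIntegrable (fun t : ℝ => t ^ (ε - 1)) volume 0 1 :=
        intervalIntegral.intervalIntegrable_rpow' (by linarith)
      exact ((intervalIntegrable_iff_integrableOn_Ioc_of_le zero_le_one).1 this).const_mul _
    · refine (ae_restrict_iff' measurableSet_Ioc).2 (Filter.Eventually.of_forall fun t ht => ?_)
      have := ht.1
      simp only [Pi.zero_apply]
      positivity
  have h4 : ENNReal.ofReal M ≤ ENNReal.ofReal (M / 2) := by
    refine h1.trans ?_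
    calc _ ≤ ENNReal.ofReal ρ * ENNReal.ofReal (M / (2 * ρ)) := by
            gcongr
            exact h2.trans h3.le
      _ = _ := by
        rw [← ENNReal.ofReal_mul hρ.le]
        congr 1
        field_simp
  rw [ENNReal.ofReal_le_ofReal_iff (by positivity)] at h4
  linarith

lemma hContent_le_of_countable {d : ℕ} {s : ℝ} (hs : 0 < s) {ι : Type*} [Countable ι]
    (E : Set (Euc d)) (U : ι → Set (Euc d)) (hE : E ⊆ ⋃ i, U i) :
    hContent d s E ≤ ∑' i, EMetric.diam (U i) ^ s := by
  classical
  obtain ⟨_⟩ := nonempty_encodable ι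
  have h0 : (fun A : Set (Euc d) => EMetric.diam A ^ s) ∅ = 0 := by
    change ediam (∅ : Set (Euc d)) ^ s = 0
    simp [hs]
  rw [← tsum_iUnion_decode₂ (fun A : Set (Euc d) => EMetric.diam A ^ s) h0 U]
  refine iInf₂_le _ ?_
  rw [Encodable.iUnion_decode₂]
  exact hE

lemma local_ineq {d : ℕ} (Γ : Set (Euc d)) (hΓ : Γ.Nonempty) (hΓc : IsClosed Γ)
    (v : Euc d → ℝ) (hv : ContDiff ℝ 1 v) (hv0 : ∀ y ∈ Γ, v y = 0)
    (hdv0 : ∀ y ∈ Γ, fderiv ℝ v y = 0)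
    (a s ε : ℝ) (ha : 0 < a) (hs0 : 0 ≤ s) (hsd : s ≤ (d : ℝ) - 1) (hε : 0 < ε)
    (x : Euc d) (hx : 0 < infDist x Γ)
    (hthick : ENNReal.ofReal (a * infDist x Γ ^ s) ≤
        hContent d s (Γ ∩ ball x (2 * infDist x Γ))) :
    ∫⁻ u in ball x (infDist x Γ / 2), ‖v u‖ₑ ≤
      ENNReal.ofReal ((2 * 10 ^ s * 3 ^ (1 + s + ((d : ℝ) - 1 - s + ε)) / (ε * min a 1)) *
        infDist x Γ ^ (1 + ((d : ℝ) - 1 - s + ε))) *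
      ∫⁻ ξ in ball x (5 * infDist x Γ),
        ENNReal.ofReal (infDist ξ Γ ^ (-((d : ℝ) - 1 - s + ε))) * ‖fderiv ℝ v ξ‖ₑ := by
  set R := infDist x Γ with hR
  set β : ℝ := (d : ℝ) - 1 - s + ε with hβ
  have hβ0 : 0 < β := by linarith
  set G : Euc d → ℝ≥0∞ := fun ξ => ENNReal.ofReal (infDist ξ Γ ^ (-β)) * ‖fderiv ℝ v ξ‖ₑ with hG
  set A := ∫⁻ u in ball x (R / 2), ‖v u‖ₑ with hA
  have hAfin : A ≠ ⊤ := by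
    obtain ⟨K, hK⟩ := (isCompact_closedBall x (R / 2)).exists_bound_of_continuousOn
      hv.continuous.continuousOn
    have : A ≤ ∫⁻ u in ball x (R / 2), ENNReal.ofReal K := by
      refine setLIntegral_mono' measurableSet_ball fun u hu => ?_
      rw [← ofReal_norm]
      exact ENNReal.ofReal_le_ofReal (hK u (ball_subset_closedBall hu))
    refine ne_top_of_le_ne_top ?_ this
    rw [setLIntegral_const]
    exact ENNReal.mul_ne_top ENNReal.ofReal_ne_top measure_ball_lt_top.ne
  rcases eq_or_ne A 0 with hA0 | hA0
  · rw [hA0]; exact zero_le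
  set M := A.toReal with hM
  have hM0 : 0 < M := ENNReal.toReal_pos hA0 hAfin
  have hMA : ENNReal.ofReal M = A := ENNReal.ofReal_toReal hAfin
  set ρ := 3 * R with hρ
  have hρ0 : 0 < ρ := by positivity
  set K := M * ε / (2 * ρ ^ (1 + s + β)) with hK
  have hK0 : 0 < K := by positivity
  set T := Γ ∩ ball x (2 * R) with hT
  have key : ∀ y ∈ T, ∃ q : ℝ, 0 < q ∧ q ≤ ρ ∧
      ENNReal.ofReal (K * q ^ s) ≤ ∫⁻ ξ in closedBall y q, G ξ := by
    intro y hy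
    have hsub : ball x (R / 2) ⊆ ball y ρ := by
      refine ball_subset_ball' ?_
      have := hy.2
      rw [mem_ball, dist_comm] at this
      linarith
    obtain ⟨t, ht0, ht1, ht⟩ := good_radius v hv y (hv0 y hy.1) ρ hρ0 ε hε M hM0
      (hMA.le.trans (lintegral_mono_set hsub))
    refine ⟨t * ρ, by positivity, by nlinarith, ?_⟩
    have h1 : ∫⁻ ξ in ball y (t * ρ), ‖fderiv ℝ v ξ‖ₑ ≤
        ENNReal.ofReal ((t * ρ) ^ β) * ∫⁻ ξ in ball y (t * ρ), G ξ := by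
      rw [← lintegral_const_mul' _ _ ENNReal.ofReal_ne_top]
      refine setLIntegral_mono' measurableSet_ball fun ξ hξ => ?_
      by_cases hξΓ : ξ ∈ Γ
      · rw [hdv0 ξ hξΓ]
        have h0 : ‖(0 : Euc d →L[ℝ] ℝ)‖ₑ = 0 := by rw [← ofReal_norm, norm_zero, ENNReal.ofReal_zero]
        exact h0.le.trans zero_le
      · have hw : 0 < infDist ξ Γ := (hΓc.notMem_iff_infDist_pos hΓ).1 hξΓ
        have hw2 : infDist ξ Γ ≤ t * ρ :=
          (infDist_le_dist_of_mem hy.1).trans (mem_ball.1 hξ).le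
        simp only [hG]
        rw [← mul_assoc, ← ENNReal.ofReal_mul (by positivity)]
        refine le_mul_of_one_le_left zero_le ?_
        rw [ENNReal.one_le_ofReal, Real.rpow_neg hw.le, ← div_eq_mul_inv,
          one_le_div (by positivity)]
        exact Real.rpow_le_rpow hw.le hw2 hβ0.le
    have h2 := ht.trans h1
    have h3 : K * (t * ρ) ^ s = ((t * ρ) ^ β)⁻¹ * (M * ε / (2 * ρ) * t ^ ((d : ℝ) - 1 + ε)) := by
      have e1 : (d : ℝ) - 1 + ε = s + β := by rw [hβ]; ring
      rw [e1, hK, Real.rpow_add ht0, Real.rpow_add hρ0, Real.rpow_add hρ0, Real.rpow_one,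
        Real.mul_rpow ht0.le hρ0.le, Real.mul_rpow ht0.le hρ0.le]
      have e2 : t ^ β ≠ 0 := by positivity
      have e3 : ρ ^ β ≠ 0 := by positivity
      have e4 : ρ ^ s ≠ 0 := by positivity
      field_simp
    rw [h3, ENNReal.ofReal_mul (by positivity)]
    calc _ ≤ ENNReal.ofReal ((t * ρ) ^ β)⁻¹ * (ENNReal.ofReal ((t * ρ) ^ β) *
          ∫⁻ ξ in ball y (t * ρ), G ξ) := by gcongr
      _ = ∫⁻ ξ in ball y (t * ρ), G ξ := by
        rw [← mul_assoc, ← ENNReal.ofReal_mul (by positivity), inv_mul_cancel₀ (by positivity)]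
        simp
      _ ≤ _ := lintegral_mono_set ball_subset_closedBall
  choose! q hq0 hqρ hqG using key
  obtain ⟨u, huT, hudisj, hucov⟩ :=
    Vitali.exists_disjoint_subfamily_covering_enlargement_closedBall T (fun y => y) q ρ hqρ 5
      (by norm_num)
  have hucount : u.Countable := hudisj.countable_of_nonempty_interior fun y hy => by
    rw [interior_closedBall _ (hq0 y (huT hy)).ne']
    exact ⟨y, mem_ball_self (hq0 y (huT hy))⟩
  have : Countable u := hucount.to_subtype
  -- lower bound for the covering sum
  have hlow : ENNReal.ofReal (min a 1 * R ^ s) ≤ ∑' y : u, ENNReal.ofReal ((10 * q y) ^ s) := by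
    rcases hs0.eq_or_lt with hs | hs
    · obtain ⟨y, hyΓ, hy⟩ := hΓc.exists_infDist_eq_dist hΓ x
      have hyT : y ∈ T := ⟨hyΓ, by rw [mem_ball, dist_comm, ← hy]; linarith⟩
      obtain ⟨b, hb, -⟩ := hucov y hyT
      refine le_trans ?_ (ENNReal.le_tsum (⟨b, hb⟩ : u))
      simp [← hs]
    · calc ENNReal.ofReal (min a 1 * R ^ s) ≤ ENNReal.ofReal (a * R ^ s) := by
            refine ENNReal.ofReal_le_ofReal ?_
            gcongr
            exact min_le_left _ _
        _ ≤ hContent d s T := hthick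
        _ ≤ ∑' y : u, EMetric.diam (closedBall (y : Euc d) (5 * q y)) ^ s := by
            refine hContent_le_of_countable hs _ _ fun y hy => ?_
            obtain ⟨b, hb, hsub⟩ := hucov y hy
            exact mem_iUnion.2 ⟨⟨b, hb⟩, hsub (mem_closedBall_self (hq0 y hy).le)⟩
        _ ≤ _ := by
            refine ENNReal.tsum_le_tsum fun y => ?_
            have hqy := hq0 y (huT y.2)
            rw [← ENNReal.ofReal_rpow_of_pos (by positivity)]
            refine ENNReal.rpow_le_rpow ?_ hs0
            refine ediam_le fun a ha b hb => ?_
            rw [edist_dist]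
            refine ENNReal.ofReal_le_ofReal ?_
            have h1 := dist_triangle_right a b (y : Euc d)
            rw [mem_closedBall] at ha hb
            linarith
  have hup : ∑' y : u, ∫⁻ ξ in closedBall (y : Euc d) (q y), G ξ ≤
      ∫⁻ ξ in ball x (5 * R), G ξ := by
    rw [← lintegral_iUnion (fun _ => measurableSet_closedBall)]
    · refine lintegral_mono_set (iUnion_subset fun y => ?_)
      have h1 := (huT y.2).2
      have h2 := hqρ y (huT y.2)
      intro ξ hξ
      rw [mem_ball] at *
      rw [mem_closedBall] at hξ
      have := dist_triangle ξ (y : Euc d) x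
      linarith
    · intro b c hbc
      exact hudisj b.2 c.2 (fun h => hbc (Subtype.ext h))
  have hfin : ENNReal.ofReal (K * (10 ^ s)⁻¹ * (min a 1 * R ^ s)) ≤
      ∫⁻ ξ in ball x (5 * R), G ξ := by
    refine le_trans ?_ hup
    rw [ENNReal.ofReal_mul (by positivity)]
    refine (mul_le_mul_right hlow _).trans ?_
    rw [← ENNReal.tsum_mul_left]
    refine ENNReal.tsum_le_tsum fun y => ?_
    refine le_trans (le_of_eq ?_) (hqG y (huT y.2))
    have hqy := hq0 y (huT y.2)
    rw [← ENNReal.ofReal_mul (by positivity), Real.mul_rpow (by norm_num) hqy.le]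
    congr 1
    have : (10 : ℝ) ^ s ≠ 0 := by positivity
    field_simp
  rw [← hMA]
  have ham : 0 < min a 1 := lt_min ha one_pos
  refine le_trans (le_of_eq ?_) (mul_le_mul_right hfin _)
  rw [← ENNReal.ofReal_mul (by positivity)]
  congr 1
  rw [hK, hρ, Real.mul_rpow (by norm_num) hx.le,
    show R ^ (1 + s + β) = R ^ (1 + β) * R ^ s by rw [← Real.rpow_add hx]; congr 1; ring]
  have e1 : R ^ (1 + β) ≠ 0 := by positivity
  have e2 : R ^ s ≠ 0 := by positivity
  have e3 : (10 : ℝ) ^ s ≠ 0 := by positivity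
  have e4 : (3 : ℝ) ^ (1 + s + β) ≠ 0 := by positivity
  field_simp

lemma assembly {E : Type*} [MeasurableSpace E] (μ : Measure E) [SFinite μ] (S : Set E)
    (hS : MeasurableSet S)
    (N₁ N₂ : E → E → ℝ≥0∞) (hN₁ : Measurable (Function.uncurry N₁))
    (hN₂ : Measurable (Function.uncurry N₂))
    (k k₁ f₀ F G H : E → ℝ≥0∞) (hk : Measurable k) (hk₁ : Measurable k₁) (hF : Measurable F)
    (hG : Measurable G) (CA : ℝ≥0∞) (hCA : CA ≠ ⊤)
    (hA : ∀ u ∈ S, f₀ u ≤ CA * ∫⁻ x in S, N₁ u x * k x ∂μ)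
    (hL : ∀ x ∈ S, ∫⁻ u, N₁ u x * F u ∂μ ≤ k₁ x * ∫⁻ ξ, N₂ ξ x * G ξ ∂μ)
    (hB : ∀ ξ, G ξ * ∫⁻ x in S, N₂ ξ x * (k x * k₁ x) ∂μ ≤ H ξ) :
    ∫⁻ u in S, f₀ u * F u ∂μ ≤ CA * ∫⁻ ξ, H ξ ∂μ := by
  have m1 : ∀ u, Measurable (fun x => N₁ u x) := fun u => hN₁.of_uncurry_left
  have m2 : ∀ u, Measurable (fun x => N₂ u x) := fun u => hN₂.of_uncurry_left
  have m1' : ∀ x, Measurable (fun u => N₁ u x) := fun u => hN₁.of_uncurry_right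
  have m2' : ∀ x, Measurable (fun u => N₂ u x) := fun u => hN₂.of_uncurry_right
  calc ∫⁻ u in S, f₀ u * F u ∂μ
      ≤ ∫⁻ u in S, CA * ∫⁻ x in S, N₁ u x * k x * F u ∂μ ∂μ := by
        refine setLIntegral_mono' hS fun u hu => ?_
        rw [lintegral_mul_const _ (show Measurable fun x => N₁ u x * k x from (m1 u).mul hk), ← mul_assoc]
        gcongr
        exact hA u hu
    _ = CA * ∫⁻ u in S, ∫⁻ x in S, N₁ u x * k x * F u ∂μ ∂μ := by
        rw [lintegral_const_mul' _ _ hCA]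
    _ = CA * ∫⁻ x in S, ∫⁻ u in S, N₁ u x * k x * F u ∂μ ∂μ := by
        rw [lintegral_lintegral_swap]
        refine Measurable.aemeasurable ?_
        exact (hN₁.mul (hk.comp measurable_snd)).mul (hF.comp measurable_fst)
    _ ≤ CA * ∫⁻ x in S, ∫⁻ ξ, N₂ ξ x * (k x * k₁ x) * G ξ ∂μ ∂μ := by
        gcongr CA * ?_
        refine setLIntegral_mono' hS fun x hx => ?_
        calc ∫⁻ u in S, N₁ u x * k x * F u ∂μ ≤ ∫⁻ u, N₁ u x * k x * F u ∂μ :=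
              setLIntegral_le_lintegral _ _
          _ = k x * ∫⁻ u, N₁ u x * F u ∂μ := by
              rw [← lintegral_const_mul _ (show Measurable fun u => N₁ u x * F u from (m1' x).mul hF)]
              refine lintegral_congr fun u => by ring
          _ ≤ k x * (k₁ x * ∫⁻ ξ, N₂ ξ x * G ξ ∂μ) := by
              gcongr
              exact hL x hx
          _ = _ := by
              rw [← mul_assoc, ← lintegral_const_mul _ (show Measurable fun u => N₂ u x * G u from (m2' x).mul hG)]
              refine lintegral_congr fun u => by ring
    _ = CA * ∫⁻ ξ, ∫⁻ x in S, N₂ ξ x * (k x * k₁ x) * G ξ ∂μ ∂μ := by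
        rw [lintegral_lintegral_swap]
        refine Measurable.aemeasurable ?_
        exact ((hN₂.comp measurable_swap).mul ((hk.mul hk₁).comp measurable_fst)).mul
          (hG.comp measurable_snd)
    _ ≤ _ := by
        gcongr with ξ
        rw [lintegral_mul_const _ (show Measurable fun x => N₂ ξ x * (k x * k₁ x) from
          (m2 ξ).mul (hk.mul hk₁)), mul_comm]
        exact hB ξ

/-- The cutoff kernel `1_{|u-x| < c w(x)}`. -/
def cutK {d : ℕ} (Γ : Set (Euc d)) (c : ℝ) (u x : Euc d) : ℝ≥0∞ :=
  {q : Euc d × Euc d | dist q.1 q.2 < c * infDist q.2 Γ}.indicator 1 (u, x)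

lemma cutK_meas {d : ℕ} (Γ : Set (Euc d)) (c : ℝ) : Measurable (Function.uncurry (cutK Γ c)) := by
  have : Function.uncurry (cutK Γ c) =
      {q : Euc d × Euc d | dist q.1 q.2 < c * infDist q.2 Γ}.indicator 1 := by
    ext ⟨u, x⟩; rfl
  rw [this]
  refine measurable_one.indicator (IsOpen.measurableSet ?_)
  refine isOpen_lt (by fun_prop) ?_
  exact continuous_const.mul ((continuous_infDist_pt Γ).comp continuous_snd)

lemma cutK_of_lt {d : ℕ} {Γ : Set (Euc d)} {c : ℝ} {u x : Euc d}
    (h : dist u x < c * infDist x Γ) : cutK Γ c u x = 1 := by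
  unfold cutK
  rw [indicator_of_mem]
  · rfl
  · exact h

lemma cutK_of_not_lt {d : ℕ} {Γ : Set (Euc d)} {c : ℝ} {u x : Euc d}
    (h : ¬ dist u x < c * infDist x Γ) : cutK Γ c u x = 0 := by
  unfold cutK
  rw [indicator_of_notMem]
  exact h

lemma cutK_lintegral {d : ℕ} (Γ : Set (Euc d)) (c : ℝ) (x : Euc d) (F : Euc d → ℝ≥0∞) :
    ∫⁻ u, cutK Γ c u x * F u = ∫⁻ u in ball x (c * infDist x Γ), F u := by
  rw [← lintegral_indicator measurableSet_ball]
  refine lintegral_congr fun u => ?_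
  by_cases h : dist u x < c * infDist x Γ
  · rw [cutK_of_lt h, one_mul, indicator_of_mem (mem_ball.2 h)]
  · rw [cutK_of_not_lt h, zero_mul, indicator_of_notMem]
    exact h

/-- Integrals of the kernel `w(x)^{-ε-d}` over `{x : |x-ξ| < 5 w(x)}`. -/
lemma upper_kernel (d : ℕ) (ε : ℝ) (hε : 0 < ε) : ∃ C : ℝ≥0∞, C ≠ ⊤ ∧
    ∀ (Γ : Set (Euc d)) (ξ : Euc d), 0 < infDist ξ Γ →
      ∫⁻ x, cutK Γ 5 ξ x * ENNReal.ofReal (infDist x Γ ^ (-(d + ε))) ≤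
        C * ENNReal.ofReal (infDist ξ Γ ^ (-ε)) := by
  set I := ∫⁻ x : Euc d, ENNReal.ofReal ((1 + ‖x‖) ^ (-(d + ε))) with hI
  have hIfin : I ≠ ⊤ := (finite_integral_one_add_norm (μ := (volume : Measure (Euc d)))
    (by simp [hε])).ne
  refine ⟨ENNReal.ofReal (11 ^ (d + ε)) * I, ENNReal.mul_ne_top ENNReal.ofReal_ne_top hIfin, ?_⟩
  intro Γ ξ hW
  set W := infDist ξ Γ with hWdef
  have hscale : ∫⁻ x : Euc d, ENNReal.ofReal ((1 + ‖W⁻¹ • (x - ξ)‖) ^ (-(d + ε))) =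
      ENNReal.ofReal (W ^ d) * I := by
    rw [lintegral_sub_right_eq_self
      (fun x : Euc d => ENNReal.ofReal ((1 + ‖W⁻¹ • x‖) ^ (-(d + ε)))) ξ]
    have hW' : W⁻¹ ≠ 0 := by positivity
    have e2 := lintegral_map_equiv (μ := (volume : Measure (Euc d)))
      (fun x => ENNReal.ofReal ((1 + ‖x‖) ^ (-(d + ε)))) (MeasurableEquiv.smul₀ W⁻¹ hW')
    have e3 : (⇑(MeasurableEquiv.smul₀ W⁻¹ hW') : Euc d → Euc d) = fun x => W⁻¹ • x := rfl
    rw [e3, Measure.map_addHaar_smul _ hW', lintegral_smul_measure] at e2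
    rw [← e2, abs_of_pos (by positivity)]
    simp [hI]
  calc ∫⁻ x, cutK Γ 5 ξ x * ENNReal.ofReal (infDist x Γ ^ (-(d + ε)))
      ≤ ∫⁻ x, ENNReal.ofReal ((W / 11) ^ (-(d + ε))) *
          ENNReal.ofReal ((1 + ‖W⁻¹ • (x - ξ)‖) ^ (-(d + ε))) := by
        refine lintegral_mono fun x => ?_
        by_cases h : dist ξ x < 5 * infDist x Γ
        · rw [cutK_of_lt h, one_mul, ← ENNReal.ofReal_mul (by positivity),
            ← Real.mul_rpow (by positivity) (by positivity)]
          refine ENNReal.ofReal_le_ofReal ?_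
          refine Real.rpow_le_rpow_of_nonpos (by positivity) ?_ (by
            have : (0 : ℝ) ≤ d := by positivity
            linarith)
          have h1 : W ≤ infDist x Γ + dist ξ x := infDist_le_infDist_add_dist
          rw [norm_smul, ← dist_eq_norm, dist_comm x ξ, Real.norm_of_nonneg (by positivity)]
          have : W / 11 * (1 + W⁻¹ * dist ξ x) = (W + dist ξ x) / 11 := by
            field_simp
          rw [this]
          linarith
        · rw [cutK_of_not_lt h, zero_mul]
          exact zero_le
    _ = ENNReal.ofReal ((W / 11) ^ (-(d + ε))) * (ENNReal.ofReal (W ^ d) * I) := by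
        rw [lintegral_const_mul' _ _ ENNReal.ofReal_ne_top, hscale]
    _ = _ := by
        rw [← mul_assoc, ← ENNReal.ofReal_mul (by positivity), mul_right_comm,
          ← ENNReal.ofReal_mul (by positivity)]
        congr 2
        rw [Real.div_rpow hW.le (by norm_num), Real.rpow_neg (by norm_num : (0:ℝ) ≤ 11),
          div_inv_eq_mul, mul_comm (W ^ _), mul_assoc]
        congr 1
        rw [← Real.rpow_natCast, ← Real.rpow_add hW]
        congr 1
        ring

lemma lower_kernel {d : ℕ} (Ω : Set (Euc d)) (hΩ : IsOpen Ω) (z : Euc d) (hz : z ∈ frontier Ω)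
    (r : ℝ) (β : ℝ) (hβ : 0 < β) (u : Euc d) (hu : u ∈ Ω ∩ ball z r) :
    ENNReal.ofReal (infDist u (frontier Ω) ^ (-(β + 1))) ≤
      ENNReal.ofReal ((4 / 3) ^ (β + 1 + d) * 6 ^ d) * (volume (ball (0 : Euc d) 1))⁻¹ *
      ∫⁻ x in Ω ∩ ball z r, cutK (frontier Ω) (1 / 2) u x *
        ENNReal.ofReal (infDist x (frontier Ω) ^ (-(β + 1 + d))) := by
  set Γ := frontier Ω with hΓ
  have hΓc : IsClosed Γ := isClosed_frontier
  have hΓn : Γ.Nonempty := ⟨z, hz⟩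
  have huΓ : u ∉ Γ := by
    rw [hΓ, hΩ.frontier_eq]
    exact fun h => h.2 hu.1
  have hW : 0 < infDist u Γ := (hΓc.notMem_iff_infDist_pos hΓn).1 huΓ
  set W := infDist u Γ with hWdef
  have hWz : W ≤ dist u z := infDist_le_dist_of_mem hz
  have hzu : 0 < dist u z := hW.trans_le hWz
  have hballΩ : ball u W ⊆ Ω := by
    refine (isPreconnected_ball : IsPreconnected (ball u W)).subset_left_of_subset_union
      (v := (closure Ω)ᶜ) hΩ isClosed_closure.isOpen_compl
      (disjoint_compl_right.mono_left subset_closure) ?_ ⟨u, mem_ball_self hW, hu.1⟩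
    intro x hx
    by_contra hcon
    rw [mem_union, not_or, notMem_compl_iff] at hcon
    have hxΓ : x ∈ Γ := by
      rw [hΓ, hΩ.frontier_eq]
      exact ⟨hcon.2, hcon.1⟩
    have := infDist_le_dist_of_mem (x := u) hxΓ
    rw [mem_ball, dist_comm] at hx
    linarith
  set c : Euc d := u + (W / 6 / dist u z) • (z - u) with hc
  have hcu : dist c u = W / 6 := by
    rw [dist_eq_norm, hc, add_sub_cancel_left, norm_smul, ← dist_eq_norm, dist_comm z u,
      Real.norm_of_nonneg (by positivity)]
    field_simp
  have hcz : dist c z = dist u z - W / 6 := by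
    have : c - z = (1 - W / 6 / dist u z) • (u - z) := by
      rw [hc]; module
    rw [dist_eq_norm, this, norm_smul, ← dist_eq_norm u z, Real.norm_of_nonneg]
    · field_simp
    · rw [sub_nonneg, div_le_one hzu]; linarith
  have hB : ∀ x ∈ ball c (W / 6), x ∈ Ω ∩ ball z r ∧ dist u x < 1 / 2 * infDist x Γ ∧
      infDist x Γ ≤ 4 / 3 * W ∧ 0 < infDist x Γ := by
    intro x hx
    rw [mem_ball] at hx
    have h1 := dist_triangle x c u
    have h2 := dist_triangle x c z
    have h3 : W ≤ infDist x Γ + dist u x := infDist_le_infDist_add_dist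
    have h4 : infDist x Γ ≤ W + dist x u := infDist_le_infDist_add_dist
    have h5 := mem_ball.1 hu.2
    rw [dist_comm u x] at *
    refine ⟨⟨hballΩ (mem_ball.2 (by linarith)), mem_ball.2 (by linarith)⟩, by linarith,
      by linarith, by linarith⟩
  have hVpos : volume (ball (0 : Euc d) 1) ≠ 0 := (measure_ball_pos _ _ one_pos).ne'
  have hVfin : volume (ball (0 : Euc d) 1) ≠ ⊤ := measure_ball_lt_top.ne
  have hint : ENNReal.ofReal ((4 / 3 * W) ^ (-(β + 1 + d))) * (ENNReal.ofReal ((W / 6) ^ d) *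
      volume (ball (0 : Euc d) 1)) ≤ ∫⁻ x in Ω ∩ ball z r, cutK Γ (1 / 2) u x *
        ENNReal.ofReal (infDist x Γ ^ (-(β + 1 + d))) := by
    have hvol := Measure.addHaar_ball_of_pos (volume : Measure (Euc d)) c
      (show 0 < W / 6 by positivity)
    rw [finrank_euclideanSpace_fin] at hvol
    rw [← hvol, ← setLIntegral_const]
    refine le_trans ?_ (lintegral_mono_set (fun x hx => (hB x hx).1 : ball c (W / 6) ⊆ _))
    refine setLIntegral_mono' measurableSet_ball fun x hx => ?_
    obtain ⟨-, h1, h2, h3⟩ := hB x hx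
    rw [cutK_of_lt h1, one_mul]
    refine ENNReal.ofReal_le_ofReal (Real.rpow_le_rpow_of_nonpos h3 h2 ?_)
    have : (0 : ℝ) ≤ d := by positivity
    linarith
  refine le_trans (le_of_eq ?_) (mul_le_mul_right hint _)
  rw [show ∀ a b c e V : ℝ≥0∞, a * b * (c * (e * V)) = (a * c * e) * (b * V) by intros; ring,
    ENNReal.inv_mul_cancel hVpos hVfin, mul_one, ← ENNReal.ofReal_mul (by positivity),
    ← ENNReal.ofReal_mul (by positivity)]
  congr 1
  rw [Real.mul_rpow (by norm_num) hW.le, Real.rpow_neg (by norm_num : (0:ℝ) ≤ 4/3), div_pow]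
  have e1 : ((4:ℝ) / 3) ^ (β + 1 + d) ≠ 0 := by positivity
  have e2 : W ^ (-(β + 1)) = W ^ (-(β + 1 + d)) * W ^ d := by
    rw [← Real.rpow_natCast, ← Real.rpow_add hW]
    congr 1
    ring
  rw [e2]
  field_simp

lemma hardy_one {d : ℕ} (Ω : Set (Euc d)) (hΩ : IsOpen Ω)
    (z : Euc d) (hz : z ∈ frontier Ω) (r : ℝ)
    (a s : ℝ) (ha : 0 < a) (hs0 : 0 ≤ s) (hsd : s ≤ (d : ℝ) - 1)
    (hthick : ∀ x ∈ Ω ∩ ball z r,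
      ENNReal.ofReal (a * infDist x (frontier Ω) ^ s) ≤
        hContent d s (frontier Ω ∩ ball x (2 * infDist x (frontier Ω))))
    (β : ℝ) (hβ : (d : ℝ) - 1 - s < β) :
    ∃ C : ℝ≥0∞, C ≠ ⊤ ∧ ∀ v : Euc d → ℝ, ContDiff ℝ 1 v → tsupport v ⊆ Ω ∩ ball z r →
      ∫⁻ u in Ω ∩ ball z r, ENNReal.ofReal (infDist u (frontier Ω) ^ (-(β + 1))) * ‖v u‖ₑ ≤
      C * ∫⁻ u in Ω ∩ ball z r,
        ENNReal.ofReal (infDist u (frontier Ω) ^ (-β)) * ‖fderiv ℝ v u‖ₑ := by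
  set Γ := frontier Ω with hΓ
  have hΓc : IsClosed Γ := isClosed_frontier
  have hΓn : Γ.Nonempty := ⟨z, hz⟩
  have hΓΩ : ∀ x ∈ Ω, x ∉ Γ := by
    intro x hx
    rw [hΓ, hΩ.frontier_eq]
    exact fun h => h.2 hx
  have hpos : ∀ x ∈ Ω ∩ ball z r, 0 < infDist x Γ := fun x hx =>
    (hΓc.notMem_iff_infDist_pos hΓn).1 (hΓΩ x hx.1)
  have hSm : MeasurableSet (Ω ∩ ball z r) := hΩ.measurableSet.inter measurableSet_ball
  set ε := (β - ((d : ℝ) - 1 - s)) / 2 with hε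
  have hε0 : 0 < ε := by rw [hε]; linarith
  set β' := (d : ℝ) - 1 - s + ε with hβ'
  have hββ : β = β' + ε := by rw [hβ', hε]; ring
  obtain ⟨CB, hCB, hB⟩ := upper_kernel d ε hε0
  have ham : 0 < min a 1 := lt_min ha one_pos
  set C₀ : ℝ := 2 * 10 ^ s * 3 ^ (1 + s + β') / (ε * min a 1) with hC₀
  have hC₀0 : 0 < C₀ := by positivity
  set CA : ℝ≥0∞ := ENNReal.ofReal ((4 / 3) ^ (β + 1 + d) * 6 ^ d) *
    (volume (ball (0 : Euc d) 1))⁻¹ with hCA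
  have hCAfin : CA ≠ ⊤ := ENNReal.mul_ne_top ENNReal.ofReal_ne_top
    (ENNReal.inv_ne_top.2 (measure_ball_pos _ _ one_pos).ne')
  refine ⟨CA * (ENNReal.ofReal C₀ * CB), ENNReal.mul_ne_top hCAfin
    (ENNReal.mul_ne_top ENNReal.ofReal_ne_top hCB), ?_⟩
  intro v hv hsupp
  have hv0 : ∀ y ∉ Ω ∩ ball z r, v y = 0 := fun y hy =>
    image_eq_zero_of_notMem_tsupport fun h => hy (hsupp h)
  have hdv0 : ∀ y ∉ Ω ∩ ball z r, fderiv ℝ v y = 0 := fun y hy =>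
    fderiv_of_notMem_tsupport ℝ fun h => hy (hsupp h)
  have h0 : ‖(0 : Euc d →L[ℝ] ℝ)‖ₑ = 0 := by rw [← ofReal_norm, norm_zero, ENNReal.ofReal_zero]
  have hwm : Measurable fun x : Euc d => infDist x Γ := (continuous_infDist_pt Γ).measurable
  have hmain := assembly (volume : Measure (Euc d)) (Ω ∩ ball z r) hSm
    (cutK Γ (1 / 2)) (cutK Γ 5) (cutK_meas _ _) (cutK_meas _ _)
    (fun x => ENNReal.ofReal (infDist x Γ ^ (-(β + 1 + d))))
    (fun x => ENNReal.ofReal (C₀ * infDist x Γ ^ (1 + β')))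
    (fun u => ENNReal.ofReal (infDist u Γ ^ (-(β + 1))))
    (fun u => ‖v u‖ₑ)
    (fun ξ => ENNReal.ofReal (infDist ξ Γ ^ (-β')) * ‖fderiv ℝ v ξ‖ₑ)
    (fun ξ => (ENNReal.ofReal C₀ * CB) *
      (ENNReal.ofReal (infDist ξ Γ ^ (-β)) * ‖fderiv ℝ v ξ‖ₑ))
    (hwm.pow_const _).ennreal_ofReal ((hwm.pow_const _).const_mul _).ennreal_ofReal
    hv.continuous.measurable.enorm
    ((hwm.pow_const _).ennreal_ofReal.mul (hv.continuous_fderiv (by norm_num)).measurable.enorm)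
    CA hCAfin
    (fun u hu => lower_kernel Ω hΩ z hz r β (by linarith) u hu)
    (by
      intro x hx
      rw [cutK_lintegral, cutK_lintegral]
      have := local_ineq Γ hΓn hΓc v hv (fun y hy => hv0 y fun h => hΓΩ y h.1 hy)
        (fun y hy => hdv0 y fun h => hΓΩ y h.1 hy) a s ε ha hs0 hsd hε0 x (hpos x hx)
        (hthick x hx)
      rw [show 1 / 2 * infDist x Γ = infDist x Γ / 2 by ring]
      exact this)
    (by
      intro ξ
      by_cases hξ : ξ ∈ Ω ∩ ball z r
      · have hw := hpos ξ hξ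
        have e1 : ∫⁻ x in Ω ∩ ball z r, cutK Γ 5 ξ x *
            (ENNReal.ofReal (infDist x Γ ^ (-(β + 1 + d))) *
              ENNReal.ofReal (C₀ * infDist x Γ ^ (1 + β'))) ≤
            ENNReal.ofReal C₀ * (CB * ENNReal.ofReal (infDist ξ Γ ^ (-ε))) := by
          calc _ = ∫⁻ x in Ω ∩ ball z r, ENNReal.ofReal C₀ * (cutK Γ 5 ξ x *
                  ENNReal.ofReal (infDist x Γ ^ (-(d + ε)))) := by
                refine setLIntegral_congr_fun hSm fun x hx => ?_
                have hwx := hpos x hx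
                rw [mul_left_comm (ENNReal.ofReal C₀), ← ENNReal.ofReal_mul (by positivity),
                  ← ENNReal.ofReal_mul (by positivity)]
                congr 2
                rw [mul_left_comm, ← Real.rpow_add hwx]
                congr 2
                rw [hββ]; ring
            _ = ENNReal.ofReal C₀ * ∫⁻ x in Ω ∩ ball z r, (cutK Γ 5 ξ x *
                  ENNReal.ofReal (infDist x Γ ^ (-(d + ε)))) := by
                rw [lintegral_const_mul' _ _ ENNReal.ofReal_ne_top]
            _ ≤ _ := by
                gcongr
                exact (setLIntegral_le_lintegral _ _).trans (hB Γ ξ hw)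
        refine (mul_le_mul_right e1 _).trans (le_of_eq ?_)
        have e2 : ENNReal.ofReal (infDist ξ Γ ^ (-β)) =
            ENNReal.ofReal (infDist ξ Γ ^ (-β')) * ENNReal.ofReal (infDist ξ Γ ^ (-ε)) := by
          rw [← ENNReal.ofReal_mul (by positivity), ← Real.rpow_add hw]
          congr 2
          rw [hββ]; ring
        rw [e2]
        ring
      · rw [hdv0 ξ hξ, h0]
        simp)
  refine hmain.trans (le_of_eq ?_)
  rw [lintegral_const_mul' _ _ (ENNReal.mul_ne_top ENNReal.ofReal_ne_top hCB), ← mul_assoc]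
  congr 1
  rw [← lintegral_indicator hSm]
  refine lintegral_congr fun x => ?_
  by_cases hx : x ∈ Ω ∩ ball z r
  · rw [indicator_of_mem hx]
  · rw [indicator_of_notMem hx, hdv0 x hx, h0, mul_zero]

lemma young_aux (w f Y p δ η : ℝ) (hw : 0 < w) (hf : 0 ≤ f) (hY : 0 ≤ Y) (hp : 1 < p)
    (hη : 0 < η) :
    w ^ (-(p - δ - 1)) * (p * f ^ (p - 1) * Y) ≤
      p * η * (w ^ (δ - p) * f ^ p) + p * η ^ (1 - p) * (w ^ δ * Y ^ p) := by
  have hA : 0 ≤ p * η * (w ^ (δ - p) * f ^ p) := by positivity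
  have hD : 0 ≤ p * η ^ (1 - p) * (w ^ δ * Y ^ p) := by positivity
  have e1 : w ^ (-(p - δ - 1)) = w ^ (δ - p) * w := by
    rw [← Real.rpow_add_one hw.ne']; congr 1; ring
  have split : ∀ q : ℝ, 0 ≤ q → q ^ p = q ^ (p - 1) * q := by
    intro q hq
    rw [← Real.rpow_add_one' hq (by linarith)]; congr 1; ring
  by_cases h : Y * w ≤ η * f
  · refine le_trans ?_ (le_add_of_nonneg_right hD)
    calc w ^ (-(p - δ - 1)) * (p * f ^ (p - 1) * Y)
        = p * w ^ (δ - p) * f ^ (p - 1) * (Y * w) := by rw [e1]; ring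
      _ ≤ p * w ^ (δ - p) * f ^ (p - 1) * (η * f) := by gcongr
      _ = _ := by rw [split f hf]; ring
  · refine le_trans ?_ (le_add_of_nonneg_left hA)
    push Not at h
    have h1 : f ≤ w * Y / η := by
      rw [le_div_iff₀ hη]; linarith
    calc w ^ (-(p - δ - 1)) * (p * f ^ (p - 1) * Y)
        ≤ w ^ (-(p - δ - 1)) * (p * (w * Y / η) ^ (p - 1) * Y) := by
          gcongr
      _ = p * η ^ (1 - p) * ((w ^ (-(p - δ - 1)) * w ^ (p - 1)) * (Y ^ (p - 1) * Y)) := by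
          rw [Real.div_rpow (by positivity) hη.le, Real.mul_rpow hw.le hY,
            show 1 - p = -(p - 1) by ring, Real.rpow_neg hη.le]
          ring
      _ = _ := by
          rw [← split Y hY, ← Real.rpow_add hw]
          congr 4
          ring

/-- Proposition 3.2: a local weighted Hardy inequality on `Ω_{z,r} = Ω ∩ B(z;r)` under
the boundary thickness condition `H^s_∞(Γ ∩ B(x;2d_Γ(x))) ≥ a·d_Γ(x)^s`, `s ∈ [0,d-1]`:
for `p ∈ (1,∞)` and `δ < p + s - d` there is `b > 0` with
`∫_{Ω_{z,r}} d_Γ^δ |∇φ|^p ≥ b ∫_{Ω_{z,r}} d_Γ^{δ-p} |φ|^p` for all `φ ∈ C_c^∞(Ω_{z,r})`. -/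
theorem stmt_10 (d : ℕ) (Ω : Set (Euc d)) (hΩopen : IsOpen Ω) (hΩconn : IsConnected Ω)
    (z : Euc d) (hz : z ∈ frontier Ω) (r : ℝ) (hr : 0 < r)
    (a s : ℝ) (ha : 0 < a) (hs0 : 0 ≤ s) (hsd : s ≤ (d : ℝ) - 1)
    (hthick : ∀ x ∈ Ω ∩ ball z r,
      ENNReal.ofReal (a * infDist x (frontier Ω) ^ s) ≤
        hContent d s (frontier Ω ∩ ball x (2 * infDist x (frontier Ω)))) :
    ∀ p : ℝ, 1 < p → ∀ δ : ℝ, δ < p + s - d → ∃ b > (0 : ℝ),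
      ∀ φ : Euc d → ℝ, ContDiff ℝ (⊤ : ℕ∞) φ → HasCompactSupport φ →
        tsupport φ ⊆ Ω ∩ ball z r →
        ENNReal.ofReal b *
            ∫⁻ x in Ω ∩ ball z r,
              ENNReal.ofReal (infDist x (frontier Ω) ^ (δ - p) * |φ x| ^ p) ≤
          ∫⁻ x in Ω ∩ ball z r,
            ENNReal.ofReal (infDist x (frontier Ω) ^ δ * ‖gradient φ x‖ ^ p) := by
  intro p hp δ hδ
  obtain ⟨C, hCfin, hC⟩ := hardy_one Ω hΩopen z hz r a s ha hs0 hsd hthick (p - δ - 1)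
    (by linarith)
  set Γ := frontier Ω with hΓ
  have hΓc : IsClosed Γ := isClosed_frontier
  have hΓn : Γ.Nonempty := ⟨z, hz⟩
  have hpos : ∀ x ∈ Ω ∩ ball z r, 0 < infDist x Γ := by
    intro x hx
    refine (hΓc.notMem_iff_infDist_pos hΓn).1 ?_
    rw [hΓ, hΩopen.frontier_eq]
    exact fun h => h.2 hx.1
  have hSm : MeasurableSet (Ω ∩ ball z r) := hΩopen.measurableSet.inter measurableSet_ball
  set c := C.toReal with hc
  have hc0 : 0 ≤ c := ENNReal.toReal_nonneg
  have hcC : ENNReal.ofReal c = C := ENNReal.ofReal_toReal hCfin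
  have hp0 : 0 < p := by linarith
  set η : ℝ := 1 / (2 * (c * p + 1)) with hη
  have hη0 : 0 < η := by positivity
  have hcη : c * (p * η) ≤ 1 / 2 := by
    rw [hη, ← mul_assoc, mul_one_div, div_le_div_iff₀ (by positivity) (by norm_num)]
    linarith
  set K : ℝ := c * (p * η ^ (1 - p)) + 1 with hK
  have hK0 : 0 < K := by positivity
  refine ⟨1 / (2 * K), by positivity, ?_⟩
  intro φ hφ hφc hφs
  set A := ∫⁻ x in Ω ∩ ball z r,
    ENNReal.ofReal (infDist x Γ ^ (δ - p) * |φ x| ^ p) with hA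
  set D := ∫⁻ x in Ω ∩ ball z r,
    ENNReal.ofReal (infDist x Γ ^ δ * ‖gradient φ x‖ ^ p) with hD
  -- finiteness of the left-hand side
  have hAfin : A ≠ ⊤ := by
    have hcont : ContinuousOn (fun x => infDist x Γ ^ (δ - p) * |φ x| ^ p) (tsupport φ) := by
      refine ContinuousOn.mul ?_ ?_
      · exact (continuous_infDist_pt Γ).continuousOn.rpow_const
          fun x hx => Or.inl (hpos x (hφs hx)).ne'
      · exact (hφ.continuous.abs.rpow_const fun x => Or.inr hp0.le).continuousOn
    obtain ⟨B, hB⟩ := IsCompact.exists_bound_of_continuousOn hφc hcont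
    have h1 : A ≤ ∫⁻ x in ball z r, ENNReal.ofReal B := by
      refine le_trans ?_ (lintegral_mono_set (inter_subset_right (s := Ω)))
      refine setLIntegral_mono' hSm fun x hx => ?_
      by_cases hxs : x ∈ tsupport φ
      · exact ENNReal.ofReal_le_ofReal ((le_abs_self _).trans (hB x hxs))
      · rw [image_eq_zero_of_notMem_tsupport hxs]
        simp [Real.zero_rpow hp0.ne']
    refine ne_top_of_le_ne_top ?_ h1
    rw [setLIntegral_const]
    exact ENNReal.mul_ne_top ENNReal.ofReal_ne_top measure_ball_lt_top.ne
  set v : Euc d → ℝ := fun x => ‖φ x‖ ^ p with hv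
  have hvC : ContDiff ℝ 1 v := (contDiff_norm_rpow hp).comp
    (hφ.of_le (by exact_mod_cast le_top))
  have hvs : tsupport v ⊆ Ω ∩ ball z r := by
    refine Subset.trans (closure_mono fun x hx => ?_) hφs
    rw [Function.mem_support] at hx ⊢
    intro h
    apply hx
    simp [hv, h, Real.zero_rpow hp0.ne']
  have hvd : ∀ x, ‖fderiv ℝ v x‖ ≤ p * |φ x| ^ (p - 1) * ‖gradient φ x‖ := by
    intro x
    have h1 := hasDerivAt_abs_rpow (φ x) hp
    have h2 := (hφ.differentiable (by simp) x).hasFDerivAt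
    have h3 : fderiv ℝ v x = (p * |φ x| ^ (p - 2) * φ x) • fderiv ℝ φ x :=
      (h1.comp_hasFDerivAt x h2).fderiv
    have h4 : ‖gradient φ x‖ = ‖fderiv ℝ φ x‖ := by
      simp [gradient]
    rw [h3, h4, norm_smul, Real.norm_eq_abs, abs_mul, abs_mul, abs_of_pos hp0,
      abs_of_nonneg (by positivity : 0 ≤ |φ x| ^ (p - 2)), mul_assoc p]
    refine le_of_eq ?_
    congr 2
    rw [← Real.rpow_add_one' (abs_nonneg _) (by linarith)]
    congr 1
    ring
  have hkey := hC v hvC hvs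
  have hleft : ∫⁻ u in Ω ∩ ball z r,
      ENNReal.ofReal (infDist u Γ ^ (-(p - δ - 1 + 1))) * ‖v u‖ₑ = A := by
    refine setLIntegral_congr_fun hSm fun x hx => ?_
    have := hpos x hx
    rw [← ofReal_norm, ← ENNReal.ofReal_mul (by positivity)]
    congr 2
    · congr 1; ring
    · simp only [hv, Real.norm_eq_abs]
      exact abs_of_nonneg (by positivity)
  have hright : ∫⁻ u in Ω ∩ ball z r,
      ENNReal.ofReal (infDist u Γ ^ (-(p - δ - 1))) * ‖fderiv ℝ v u‖ₑ ≤
      ENNReal.ofReal (p * η) * A + ENNReal.ofReal (p * η ^ (1 - p)) * D := by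
    rw [hA, hD, ← lintegral_const_mul' _ _ ENNReal.ofReal_ne_top,
      ← lintegral_const_mul' _ _ ENNReal.ofReal_ne_top, ← lintegral_add_left]
    · refine setLIntegral_mono' hSm fun x hx => ?_
      have hw := hpos x hx
      rw [← ofReal_norm, ← ENNReal.ofReal_mul (by positivity), ← ENNReal.ofReal_mul (by positivity),
        ← ENNReal.ofReal_mul (by positivity), ← ENNReal.ofReal_add (by positivity) (by positivity)]
      refine ENNReal.ofReal_le_ofReal ?_
      refine le_trans ?_ (young_aux (infDist x Γ) |φ x| ‖gradient φ x‖ p δ η hw (abs_nonneg _)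
        (norm_nonneg _) hp hη0)
      gcongr
      exact hvd x
    · refine Measurable.const_mul (Measurable.ennreal_ofReal ?_) _
      exact ((continuous_infDist_pt Γ).measurable.pow_const _).mul
        (hφ.continuous.abs.measurable.pow_const _)
  rw [hleft] at hkey
  rcases eq_or_ne D ⊤ with hDt | hDt
  · rw [hDt]; exact le_top
  have h5 := hkey.trans (mul_le_mul_right hright _)
  rw [← hcC, ← ENNReal.ofReal_toReal hAfin, ← ENNReal.ofReal_toReal hDt,
    ← ENNReal.ofReal_mul (by positivity), ← ENNReal.ofReal_mul (by positivity),
    ← ENNReal.ofReal_add (by positivity) (by positivity), ← ENNReal.ofReal_mul hc0,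
    ENNReal.ofReal_le_ofReal_iff (by positivity)] at h5
  rw [← ENNReal.ofReal_toReal hAfin, ← ENNReal.ofReal_toReal hDt,
    ← ENNReal.ofReal_mul (by positivity)]
  refine ENNReal.ofReal_le_ofReal ?_
  have hA0 : 0 ≤ A.toReal := ENNReal.toReal_nonneg
  have hD0 : 0 ≤ D.toReal := ENNReal.toReal_nonneg
  rw [one_div_mul_eq_div, div_le_iff₀ (by positivity)]
  have h6 := mul_le_mul_of_nonneg_right hcη hA0
  have h7 : K * D.toReal = c * (p * η ^ (1 - p)) * D.toReal + D.toReal := by rw [hK]; ring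
  nlinarith
end
end

section
/- Let Ω ⊆ ℝ^d be a domain with boundary Γ, z ∈ Γ and r > 0, and let p̃ ∈ (1,∞) and δ̃ ∈ ℝ. Suppose there is b > 0 such that the weighted Hardy inequality ∫_{Ω_{z,r}} d_Γ(x)^{δ̃}·|∇φ(x)|^{p̃} dx ≥ b·∫_{Ω_{z,r}} d_Γ(x)^{δ̃−p̃}·|φ(x)|^{p̃} dx holds for all φ ∈ C_c^∞(Ω_{z,r}), where Ω_{z,r} = Ω ∩ B(z;r). Then for every α > 0 there is b' > 0 such that ∫_{Ω_{z,r}} d_Γ(x)^{δ̃+α}·|∇φ(x)|^{p̃+α} dx ≥ b'·∫_{Ω_{z,r}} d_Γ(x)^{δ̃−p̃}·|φ(x)|^{p̃+α} dx for all φ ∈ C_c^∞(Ω_{z,r}). -/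
open MeasureTheory Metric Set
open scoped ENNReal NNReal

noncomputable section

theorem aux_tendsto {E : Type*} [TopologicalSpace E] [T2Space E] [MeasurableSpace E]
    [OpensMeasurableSpace E] (μ : Measure E) [IsFiniteMeasureOnCompacts μ] (K : Set E)
    (hK : IsCompact K) (H : ℝ → E → ℝ)
    (hH : ContinuousOn (fun q : ℝ × E => H q.1 q.2) (Icc 0 1 ×ˢ K)) :
    Filter.Tendsto (fun n : ℕ => ∫⁻ x in K, ENNReal.ofReal (H (1 / ((n : ℝ) + 1)) x) ∂μ)
      Filter.atTop (nhds (∫⁻ x in K, ENNReal.ofReal (H 0 x) ∂μ)) := by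
  have hcpt : IsCompact ((Icc 0 1 : Set ℝ) ×ˢ K) := isCompact_Icc.prod hK
  obtain ⟨C, hC⟩ := hcpt.exists_bound_of_continuousOn hH
  have hmem : ∀ n : ℕ, (1 / ((n : ℝ) + 1)) ∈ Icc (0 : ℝ) 1 := by
    intro n
    have : (0 : ℝ) < n + 1 := by positivity
    refine ⟨by positivity, ?_⟩
    rw [div_le_one this]
    have : (0 : ℝ) ≤ n := by positivity
    linarith
  have hKm : MeasurableSet K := hK.measurableSet
  refine tendsto_lintegral_of_dominated_convergence' (fun _ => ENNReal.ofReal C) ?_ ?_ ?_ ?_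
  · intro n
    refine ENNReal.measurable_ofReal.comp_aemeasurable ?_
    refine ContinuousOn.aemeasurable ?_ hKm
    exact hH.comp (f := fun x : E => ((1 / ((n : ℝ) + 1)), x)) (by fun_prop)
      (fun x hx => ⟨hmem n, hx⟩)
  · intro n
    refine (ae_restrict_iff' hKm).2 (Filter.Eventually.of_forall fun x hx => ?_)
    exact ENNReal.ofReal_le_ofReal ((le_abs_self _).trans (hC (_, x) ⟨hmem n, hx⟩))
  · rw [lintegral_const, Measure.restrict_apply_univ]
    exact ENNReal.mul_ne_top ENNReal.ofReal_ne_top hK.measure_lt_top.ne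
  · refine (ae_restrict_iff' hKm).2 (Filter.Eventually.of_forall fun x hx => ?_)
    refine (ENNReal.continuous_ofReal.tendsto _).comp ?_
    have h0 : ((0 : ℝ), x) ∈ (Icc 0 1 : Set ℝ) ×ˢ K := ⟨⟨le_refl _, zero_le_one⟩, hx⟩
    have h1 := hH _ h0
    refine h1.tendsto.comp (f := fun n : ℕ => ((1 / ((n : ℝ) + 1)), x)) ?_
    refine tendsto_nhdsWithin_iff.2 ⟨?_, Filter.Eventually.of_forall fun n => ⟨hmem n, hx⟩⟩
    exact tendsto_one_div_add_atTop_nhds_zero_nat.prodMk_nhds tendsto_const_nhds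

theorem aux_young (X Y l a p : ℝ) (hX : 0 ≤ X) (hY : 0 ≤ Y) (hl : 0 < l) (ha : 0 < a)
    (hp : 0 < p) :
    X ^ a * Y ^ p ≤ l ^ p * X ^ (p + a) + l ^ (-a) * Y ^ (p + a) := by
  have e1 : X ^ (p + a) = X ^ p * X ^ a := Real.rpow_add_of_nonneg hX hp.le ha.le
  have e2 : Y ^ (p + a) = Y ^ p * Y ^ a := Real.rpow_add_of_nonneg hY hp.le ha.le
  have n1 : 0 ≤ l ^ p * X ^ (p + a) := by positivity
  have n2 : 0 ≤ l ^ (-a) * Y ^ (p + a) := by positivity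
  rcases le_total Y (l * X) with h | h
  · have : Y ^ p ≤ l ^ p * X ^ p := by
      rw [← Real.mul_rpow hl.le hX]
      exact Real.rpow_le_rpow hY h hp.le
    have : X ^ a * Y ^ p ≤ X ^ a * (l ^ p * X ^ p) := by gcongr
    rw [e1] at *
    linarith
  · have h1 : l ^ a * X ^ a ≤ Y ^ a := by
      rw [← Real.mul_rpow hl.le hX]
      exact Real.rpow_le_rpow (by positivity) h ha.le
    have h2 : X ^ a ≤ l ^ (-a) * Y ^ a := by
      rw [Real.rpow_neg hl.le, ← div_eq_inv_mul, le_div_iff₀ (by positivity)]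
      linarith
    have : X ^ a * Y ^ p ≤ (l ^ (-a) * Y ^ a) * Y ^ p := by gcongr
    rw [e2] at *
    linarith

theorem aux_deriv (t s u : ℝ) (ht : 0 < t) :
    HasDerivAt (fun u : ℝ => (u ^ 2 + t) ^ (s / 2) - t ^ (s / 2))
      (s * u * (u ^ 2 + t) ^ (s / 2 - 1)) u := by
  have h1 : HasDerivAt (fun u : ℝ => u ^ 2 + t) (2 * u) u := by
    simpa using (hasDerivAt_pow 2 u).add_const t
  have h2 := (h1.rpow_const (p := s / 2) (Or.inl (by positivity))).sub_const (t ^ (s / 2))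
  exact h2.congr_deriv (by ring)

theorem aux_deriv_bound (t s u : ℝ) (ht : 0 < t) (hs : 0 < s) :
    |s * u * (u ^ 2 + t) ^ (s / 2 - 1)| ≤ s * (u ^ 2 + t) ^ ((s - 1) / 2) := by
  have hpos : 0 < u ^ 2 + t := by positivity
  have e : (u ^ 2 + t) ^ ((s - 1) / 2) = (u ^ 2 + t) ^ (1 / 2 : ℝ) * (u ^ 2 + t) ^ (s / 2 - 1) := by
    rw [← Real.rpow_add hpos]; congr 1; ring
  rw [abs_mul, abs_mul, abs_of_pos hs, abs_of_pos (Real.rpow_pos_of_pos hpos _), e, ← mul_assoc]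
  have : |u| ≤ (u ^ 2 + t) ^ (1 / 2 : ℝ) := by
    rw [← Real.sqrt_eq_rpow]
    exact Real.abs_le_sqrt (by linarith)
  gcongr

theorem aux_sq (u c : ℝ) : (u ^ 2 + 0) ^ (c / 2) = |u| ^ c := by
  rw [add_zero, ← sq_abs, ← Real.rpow_natCast, ← Real.rpow_mul (abs_nonneg u)]
  congr 1; push_cast; ring

theorem aux_restrict {E : Type*} [MeasurableSpace E] (μ : Measure E) (K S : Set E)
    (hK : MeasurableSet K) (hKS : K ⊆ S) (f : E → ℝ≥0∞) (hf : ∀ x, x ∉ K → f x = 0) :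
    ∫⁻ x in S, f x ∂μ = ∫⁻ x in K, f x ∂μ := by
  have : f = K.indicator f := by
    ext x
    by_cases hx : x ∈ K
    · simp [hx]
    · simp [hx, hf x hx]
  rw [this, lintegral_indicator hK, lintegral_indicator hK, Measure.restrict_restrict hK,
    Measure.restrict_restrict hK, inter_eq_left.2 hKS, inter_self]

theorem aux_gradient {d : ℕ} (φ : EuclideanSpace ℝ (Fin d) → ℝ) (x : EuclideanSpace ℝ (Fin d)) :
    ‖gradient φ x‖ = ‖fderiv ℝ φ x‖ := by
  simp [gradient]

/-- Parameter shift for local weighted Hardy inequalities (Lemma 2.1 of Lehrbäck,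
localized): if the Hardy inequality on `Ω_{z,r} = Ω ∩ B(z;r)` holds with parameters
`p̃ ∈ (1,∞)` and `δ̃`, then for every `α > 0` it also holds with parameters `p̃ + α` and
`δ̃ + α` (the right-hand weight exponent `δ̃ - p̃` being unchanged). -/
theorem stmt_13 (d : ℕ) (Ω : Set (Euc d)) (hΩopen : IsOpen Ω) (hΩconn : IsConnected Ω)
    (z : Euc d) (hz : z ∈ frontier Ω) (r : ℝ) (hr : 0 < r)
    (p δ : ℝ) (hp : 1 < p) (b : ℝ) (hb : 0 < b)
    (hHardy : ∀ φ : Euc d → ℝ, ContDiff ℝ (⊤ : ℕ∞) φ → HasCompactSupport φ →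
      tsupport φ ⊆ Ω ∩ ball z r →
      ENNReal.ofReal b *
          ∫⁻ x in Ω ∩ ball z r,
            ENNReal.ofReal (infDist x (frontier Ω) ^ (δ - p) * |φ x| ^ p) ≤
        ∫⁻ x in Ω ∩ ball z r,
          ENNReal.ofReal (infDist x (frontier Ω) ^ δ * ‖gradient φ x‖ ^ p)) :
    ∀ α : ℝ, 0 < α → ∃ b' > (0 : ℝ),
      ∀ φ : Euc d → ℝ, ContDiff ℝ (⊤ : ℕ∞) φ → HasCompactSupport φ →
        tsupport φ ⊆ Ω ∩ ball z r →
        ENNReal.ofReal b' *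
            ∫⁻ x in Ω ∩ ball z r,
              ENNReal.ofReal (infDist x (frontier Ω) ^ (δ - p) * |φ x| ^ (p + α)) ≤
          ∫⁻ x in Ω ∩ ball z r,
            ENNReal.ofReal
              (infDist x (frontier Ω) ^ (δ + α) * ‖gradient φ x‖ ^ (p + α)) := by
  intro α hα
  have hp0 : 0 < p := by linarith
  set s : ℝ := 1 + α / p with hs
  have hs1 : 1 < s := by have : 0 < α / p := by positivity
                         linarith
  have hs0 : 0 < s := by linarith
  have hsp : s * p = p + α := by rw [hs]; field_simp
  have hsp' : (s - 1) * p = α := by rw [hs]; field_simp; ring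
  set l : ℝ := (b / 2) ^ (1 / p) / s with hl
  have hl0 : 0 < l := by positivity
  have hlp : s ^ p * l ^ p = b / 2 := by
    rw [hl, ← Real.mul_rpow hs0.le (by positivity), mul_div_cancel₀ _ hs0.ne',
      ← Real.rpow_mul (by positivity), one_div_mul_cancel hp0.ne', Real.rpow_one]
  set C : ℝ := s ^ p * l ^ (-α) with hC
  have hC0 : 0 < C := by positivity
  refine ⟨(b / 2) / C, by positivity, ?_⟩
  intro φ hφ hφc hφs
  set S := Ω ∩ ball z r with hS
  set K := tsupport φ with hKdef
  have hK : IsCompact K := hφc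
  have hKm : MeasurableSet K := hK.measurableSet
  set D : Euc d → ℝ := fun x => infDist x (frontier Ω) with hD
  have hDpos : ∀ x ∈ S, 0 < D x := by
    intro x hx
    refine (isClosed_frontier.notMem_iff_infDist_pos ⟨z, hz⟩).1 ?_
    rw [hΩopen.frontier_eq]
    exact fun h => h.2 hx.1
  have hDcont : Continuous D := continuous_infDist_pt _
  have hDw : ∀ c : ℝ, ContinuousOn (fun q : ℝ × Euc d => D q.2 ^ c) (Icc 0 1 ×ˢ K) := by
    intro c q hq
    have : ContinuousAt (fun q : ℝ × Euc d => D q.2) q := by fun_prop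
    exact (this.rpow_const (Or.inl (hDpos _ (hφs hq.2)).ne')).continuousWithinAt
  have hφcont : Continuous φ := hφ.continuous
  have hGcont : Continuous (fun x => ‖fderiv ℝ φ x‖) :=
    (hφ.continuous_fderiv (by simp)).norm
  have hφ0 : ∀ x, x ∉ K → φ x = 0 := fun x hx => image_eq_zero_of_notMem_tsupport hx
  have hG0 : ∀ x, x ∉ K → fderiv ℝ φ x = 0 := fun x hx => by
    have := notMem_subset (support_fderiv_subset ℝ (f := φ)) hx
    simpa using this
  -- the two integrands on `K`
  let HL : ℝ → Euc d → ℝ := fun t x =>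
    D x ^ (δ - p) * |(φ x ^ 2 + |t|) ^ (s / 2) - |t| ^ (s / 2)| ^ p
  let HR : ℝ → Euc d → ℝ := fun t x =>
    D x ^ δ * (s * (φ x ^ 2 + |t|) ^ ((s - 1) / 2) * ‖fderiv ℝ φ x‖) ^ p
  have hHL : ContinuousOn (fun q : ℝ × Euc d => HL q.1 q.2) (Icc 0 1 ×ˢ K) := by
    refine (hDw _).mul (Continuous.continuousOn ?_)
    refine Continuous.rpow_const ?_ (fun _ => Or.inr hp0.le)
    refine (Continuous.sub ?_ ?_).abs
    · exact Continuous.rpow_const (by fun_prop) (fun _ => Or.inr (by positivity))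
    · exact Continuous.rpow_const (by fun_prop) (fun _ => Or.inr (by positivity))
  have hHR : ContinuousOn (fun q : ℝ × Euc d => HR q.1 q.2) (Icc 0 1 ×ˢ K) := by
    refine (hDw _).mul (Continuous.continuousOn ?_)
    refine Continuous.rpow_const ?_ (fun _ => Or.inr hp0.le)
    refine Continuous.mul (Continuous.mul continuous_const ?_) (hGcont.comp continuous_snd)
    exact Continuous.rpow_const (by fun_prop) (fun _ => Or.inr (by linarith))
  have key : ∀ n : ℕ, ENNReal.ofReal b *
      ∫⁻ x in K, ENNReal.ofReal (HL (1 / ((n : ℝ) + 1)) x) ≤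
        ∫⁻ x in K, ENNReal.ofReal (HR (1 / ((n : ℝ) + 1)) x) := by
    intro n
    have ht : (0 : ℝ) < 1 / ((n : ℝ) + 1) := by positivity
    generalize (1 / ((n : ℝ) + 1)) = t at ht
    let ψ : Euc d → ℝ := fun x => (φ x ^ 2 + t) ^ (s / 2) - t ^ (s / 2)
    have hψd : ContDiff ℝ (⊤ : ℕ∞) ψ := by
      refine ContDiff.sub ?_ contDiff_const
      exact ((hφ.pow 2).add contDiff_const).rpow_const_of_ne (fun x => by positivity)
    have hψ0 : ∀ x, φ x = 0 → ψ x = 0 := by intro x hx; simp [ψ, hx]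
    have hψK : tsupport ψ ⊆ K :=
      closure_mono (fun x hx h => hx (hψ0 x h))
    have hψc : HasCompactSupport ψ := hφc.of_isClosed_subset (isClosed_tsupport _) hψK
    have hH := hHardy ψ hψd hψc (hψK.trans hφs)
    have hψG : ∀ x, fderiv ℝ ψ x =
        (s * φ x * (φ x ^ 2 + t) ^ (s / 2 - 1)) • fderiv ℝ φ x := by
      intro x
      have h1 : HasFDerivAt φ (fderiv ℝ φ x) x :=
        (hφ.differentiable (by simp) x).hasFDerivAt
      exact ((aux_deriv t s (φ x) ht).comp_hasFDerivAt x h1).fderiv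
    rw [aux_restrict volume K S hKm hφs, aux_restrict volume K S hKm hφs] at hH
    · refine le_trans (le_of_eq ?_) (hH.trans ?_)
      · simp only [HL, abs_of_pos ht, ψ, hD]
      · refine setLIntegral_mono' hKm (fun x hx => ENNReal.ofReal_le_ofReal ?_)
        have hDx := hDpos x (hφs hx)
        simp only [HR, abs_of_pos ht]
        refine mul_le_mul_of_nonneg_left ?_ (by positivity)
        refine Real.rpow_le_rpow (norm_nonneg _) ?_ hp0.le
        rw [aux_gradient, hψG x, norm_smul, Real.norm_eq_abs]
        exact mul_le_mul_of_nonneg_right (aux_deriv_bound t s _ ht hs0) (norm_nonneg _)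
    · intro x hx
      rw [aux_gradient, hψG x, hG0 x hx]
      simp [Real.zero_rpow hp0.ne']
    · intro x hx
      rw [hψ0 x (hφ0 x hx)]
      simp [Real.zero_rpow hp0.ne']
  have lim : ENNReal.ofReal b * ∫⁻ x in K, ENNReal.ofReal (HL 0 x) ≤
        ∫⁻ x in K, ENNReal.ofReal (HR 0 x) := by
    refine le_of_tendsto_of_tendsto' (ENNReal.Tendsto.const_mul (aux_tendsto volume K hK HL hHL)
      (Or.inr ENNReal.ofReal_ne_top)) (aux_tendsto volume K hK HR hHR) key
  have hHL0 : ∀ x, HL 0 x = D x ^ (δ - p) * |φ x| ^ (p + α) := by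
    intro x
    have : (0 : ℝ) ^ (s / 2) = 0 := Real.zero_rpow (by positivity)
    simp only [HL, abs_zero, aux_sq, this, sub_zero]
    rw [abs_of_nonneg (by positivity), ← Real.rpow_mul (abs_nonneg _), hsp]
  have hHR0 : ∀ x ∈ K, HR 0 x ≤ b / 2 * (D x ^ (δ - p) * |φ x| ^ (p + α)) +
      C * (D x ^ (δ + α) * ‖gradient φ x‖ ^ (p + α)) := by
    intro x hx
    have hDx := hDpos x (hφs hx)
    rw [aux_gradient]
    have hY := aux_young (|φ x|) (D x * ‖fderiv ℝ φ x‖) l α p (abs_nonneg _) (by positivity)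
      hl0 hα hp0
    have e1 : HR 0 x = s ^ p * D x ^ (δ - p) * (|φ x| ^ α * (D x * ‖fderiv ℝ φ x‖) ^ p) := by
      simp only [HR, abs_zero, aux_sq]
      rw [Real.mul_rpow (by positivity) (by positivity), Real.mul_rpow (by positivity)
        (by positivity), ← Real.rpow_mul (abs_nonneg _), hsp', Real.mul_rpow hDx.le (by positivity)]
      have : D x ^ δ = D x ^ (δ - p) * D x ^ p := by
        rw [← Real.rpow_add hDx]; congr 1; ring
      rw [this]; ring
    have e2 : D x ^ (δ + α) = D x ^ (δ - p) * D x ^ (p + α) := by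
      rw [← Real.rpow_add hDx]; congr 1; ring
    rw [e1, e2, ← hlp, hC]
    refine (mul_le_mul_of_nonneg_left hY (by positivity)).trans (le_of_eq ?_)
    rw [Real.mul_rpow hDx.le (norm_nonneg _)]
    ring
  have hI : ∫⁻ x in S, ENNReal.ofReal (D x ^ (δ - p) * |φ x| ^ (p + α)) =
      ∫⁻ x in K, ENNReal.ofReal (D x ^ (δ - p) * |φ x| ^ (p + α)) := by
    refine aux_restrict volume K S hKm hφs _ ?_
    intro x hx
    simp [hφ0 x hx, Real.zero_rpow (by positivity : p + α ≠ 0)]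
  have hcI : ContinuousOn (fun x => D x ^ (δ - p) * |φ x| ^ (p + α)) K := by
    have := hHL.comp (f := fun x : Euc d => ((0 : ℝ), x)) (s := K) (by fun_prop)
      (fun x hx => ⟨⟨le_refl _, zero_le_one⟩, hx⟩)
    refine this.congr (fun x hx => ?_)
    exact (hHL0 x).symm
  have hIfin : ∫⁻ x in K, ENNReal.ofReal (D x ^ (δ - p) * |φ x| ^ (p + α)) ≠ ⊤ := by
    have := (hcI.integrableOn_compact (μ := volume) hK).lintegral_lt_top
    exact this.ne
  have hIm : AEMeasurable (fun x => ENNReal.ofReal (D x ^ (δ - p) * |φ x| ^ (p + α)))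
      (volume.restrict K) :=
    ENNReal.measurable_ofReal.comp_aemeasurable (hcI.aemeasurable hKm)
  simp only [hHL0] at lim
  change ENNReal.ofReal (b / 2 / C) * ∫⁻ x in S, ENNReal.ofReal (D x ^ (δ - p) * |φ x| ^ (p + α))
    ≤ ∫⁻ x in S, ENNReal.ofReal (D x ^ (δ + α) * ‖gradient φ x‖ ^ (p + α))
  rw [hI]
  have hJ : ∫⁻ x in K, ENNReal.ofReal (D x ^ (δ + α) * ‖gradient φ x‖ ^ (p + α)) ≤
      ∫⁻ x in S, ENNReal.ofReal (D x ^ (δ + α) * ‖gradient φ x‖ ^ (p + α)) :=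
    lintegral_mono_set hφs
  have hsum : ∫⁻ x in K, ENNReal.ofReal (HR 0 x) ≤
      ENNReal.ofReal (b / 2) * (∫⁻ x in K, ENNReal.ofReal (D x ^ (δ - p) * |φ x| ^ (p + α))) +
      ENNReal.ofReal C *
        ∫⁻ x in K, ENNReal.ofReal (D x ^ (δ + α) * ‖gradient φ x‖ ^ (p + α)) := by
    rw [← lintegral_const_mul' _ _ ENNReal.ofReal_ne_top,
      ← lintegral_const_mul' _ _ ENNReal.ofReal_ne_top, ← lintegral_add_left' (hIm.const_mul _)]
    refine setLIntegral_mono' hKm (fun x hx => ?_)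
    have hDx := hDpos x (hφs hx)
    rw [← ENNReal.ofReal_mul (by positivity), ← ENNReal.ofReal_mul hC0.le,
      ← ENNReal.ofReal_add (by positivity) (by positivity)]
    exact ENNReal.ofReal_le_ofReal (hHR0 x hx)
  refine le_trans ?_ hJ
  generalize (∫⁻ x in K, ENNReal.ofReal (D x ^ (δ - p) * |φ x| ^ (p + α))) = I at *
  generalize (∫⁻ x in K, ENNReal.ofReal (D x ^ (δ + α) * ‖gradient φ x‖ ^ (p + α))) = J at *
  have h1 := lim.trans hsum
  have hbb : ENNReal.ofReal b = ENNReal.ofReal (b / 2) + ENNReal.ofReal (b / 2) := by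
    rw [← ENNReal.ofReal_add (by positivity) (by positivity)]; congr 1; ring
  rw [hbb, add_mul] at h1
  have h2 := (ENNReal.add_le_add_iff_left (ENNReal.mul_ne_top ENNReal.ofReal_ne_top hIfin)).1 h1
  rw [ENNReal.ofReal_div_of_pos hC0, ENNReal.div_eq_inv_mul, mul_assoc]
  calc _ ≤ (ENNReal.ofReal C)⁻¹ * (ENNReal.ofReal C * J) := by gcongr
    _ = J := by
      rw [← mul_assoc, ENNReal.inv_mul_cancel (by simpa using hC0) ENNReal.ofReal_ne_top, one_mul]
end
end
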